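/- Let p, m, n ∈ ℕ with p ≤ m ≤ n and let x ∈ ℝ. Then the product of three Hermite polynomials linearizes as H_p(x)·H_m(x)·H_n(x) = Σ_{k=0}^{⌊(p+m+n)/2⌋} f_{k,p,m,n}·H_{p+m+n−2k}(x), where f_{k,p,m,n} = d_{k,p,m,n} if 0 ≤ k ≤ p−1 and f_{k,p,m,n} = e_{k,p,m,n} if p ≤ k ≤ ⌊(p+m+n)/2⌋, with d_{k,p,m,n} := [(m+n)!·p!·2^k/(k!(p−k)!(m+n−k)!)]·₄F₃(−k, −m, −n, −m−n+k; 1+p−k, (−m−n)/2, (1−m−n)/2; 1/4) and e_{k,p,m,n} := [m!·n!·(m+n+2p−2k)!·2^k/((k−p)!(m+p−k)!(n+p−k)!(p+m+n−2k)!)]·₄F₃(−p, −m−p+k, −n−p+k, −m−n−p+2k; 1+k−p, (2k−2p−m−n)/2, (1+2k−2p−m−n)/2; 1/4). -/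

import Mathlib

open MeasureTheory

/-- Pochhammer symbol `(a)_j` for real `a` and natural `j`. -/
noncomputable def poch (a : ℝ) (j : ℕ) : ℝ := (ascPochhammer ℝ j).eval a

/-- Pochhammer symbol `(a)_j` for integer index, with the convention
`(a)_{-j} = 1/((a-1)(a-2)⋯(a-j))` for `j ≥ 1`. -/
noncomputable def pochZ (a : ℝ) (j : ℤ) : ℝ :=
  if 0 ≤ j then poch a j.toNat
  else (∏ i ∈ Finset.range (-j).toNat, (a - (i + 1)))⁻¹

/-- Factorial of an integer: `j!` for `j ≥ 0` and `0` for `j < 0`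
(encoding `1/(negative integer)! = 0` via Lean's division by zero). -/
noncomputable def ifact (j : ℤ) : ℝ := if 0 ≤ j then (j.toNat.factorial : ℝ) else 0

/-- Generalized hypergeometric sum `ᵣF_s(a; b; z)` (intended for terminating series,
where all terms beyond the termination index vanish). -/
noncomputable def hypSum (a b : List ℝ) (z : ℝ) : ℝ :=
  ∑' j : ℕ, ((a.map fun t => poch t j).prod /
    ((b.map fun t => poch t j).prod * (j.factorial : ℝ))) * z ^ j

/-- Physicists' Hermite polynomial `H_n(x)`. -/
noncomputable def hermiteH (n : ℕ) (x : ℝ) : ℝ :=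
  (n.factorial : ℝ) * ∑ k ∈ Finset.range (n / 2 + 1),
    (-1) ^ k * (2 * x) ^ (n - 2 * k) / ((k.factorial : ℝ) * (n - 2 * k).factorial)

/-- The coefficient `d_{k,p,m,n}` in the linearization of a product of three
Hermite polynomials. -/
noncomputable def hermd (k p m n : ℕ) : ℝ :=
  ((m + n).factorial : ℝ) * p.factorial * 2 ^ k /
      ((k.factorial : ℝ) * ifact ((p : ℤ) - k) * ifact ((m : ℤ) + n - k)) *
    hypSum [-(k : ℝ), -(m : ℝ), -(n : ℝ), -(m : ℝ) - n + k]
      [1 + (p : ℝ) - k, (-(m : ℝ) - n) / 2, (1 - (m : ℝ) - n) / 2] (1 / 4)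

/-- The coefficient `e_{k,p,m,n}` in the linearization of a product of three
Hermite polynomials. -/
noncomputable def herme (k p m n : ℕ) : ℝ :=
  (m.factorial : ℝ) * n.factorial * ifact ((m : ℤ) + n + 2 * p - 2 * k) * 2 ^ k /
      (ifact ((k : ℤ) - p) * ifact ((m : ℤ) + p - k) * ifact ((n : ℤ) + p - k) *
        ifact ((p : ℤ) + m + n - 2 * k)) *
    hypSum [-(p : ℝ), -(m : ℝ) - p + k, -(n : ℝ) - p + k, -(m : ℝ) - n - p + 2 * k]
      [1 + (k : ℝ) - p, (2 * (k : ℝ) - 2 * p - m - n) / 2,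
        (1 + 2 * (k : ℝ) - 2 * p - m - n) / 2] (1 / 4)

/-- The Hermite linearization coefficient `f_{k,p,m,n}`. -/
noncomputable def hermf (k p m n : ℕ) : ℝ :=
  if k < p then hermd k p m n else herme k p m n

/-- The coefficient of `H_{m+n-2j}` in the linearization of `H_m H_n`. -/
noncomputable def hermiteLin (m n j : ℕ) : ℝ :=
  2 ^ j * (m.choose j : ℝ) * (n.descFactorial j : ℝ)

theorem sum_range_eq_sum_range_of_vanish {f : ℕ → ℝ} {a b : ℕ}
    (ha : ∀ i, a ≤ i → f i = 0) (hb : ∀ i, b ≤ i → f i = 0) :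
    ∑ i ∈ Finset.range a, f i = ∑ i ∈ Finset.range b, f i := by
  rcases le_total a b with h | h
  · exact Finset.sum_subset (Finset.range_mono h) fun i _ hi => ha i (by simpa using hi)
  · exact (Finset.sum_subset (Finset.range_mono h) fun i _ hi => hb i (by simpa using hi)).symm

theorem poch_zero (a : ℝ) : poch a 0 = 1 := by simp [poch]

theorem poch_succ (a : ℝ) (j : ℕ) : poch a (j + 1) = poch a j * (a + j) := by
  simp [poch, ascPochhammer_succ_eval]

theorem poch_neg_natCast (a j : ℕ) : poch (-(a : ℝ)) j = (-1) ^ j * (a.descFactorial j : ℝ) := by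
  induction j with
  | zero => simp [poch_zero]
  | succ j ih =>
    rw [poch_succ, ih, Nat.descFactorial_succ]
    rcases le_or_gt j a with h | h
    · push_cast [Nat.cast_sub h]; ring
    · simp [Nat.descFactorial_of_lt h]

theorem poch_one_add_natCast (a j : ℕ) :
    poch (1 + (a : ℝ)) j = ((a + j).factorial : ℝ) / a.factorial := by
  have ha : (a.factorial : ℝ) ≠ 0 := by positivity
  induction j with
  | zero => simp [poch_zero, ha]
  | succ j ih =>
    rw [poch_succ, ih, ← add_assoc, Nat.factorial_succ]
    push_cast; ring

theorem poch_half_mul_poch_half (N j : ℕ) :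
    poch (-(N : ℝ) / 2) j * poch ((1 - (N : ℝ)) / 2) j
      = (N.descFactorial (2 * j) : ℝ) * (1 / 4) ^ j := by
  have h : poch (-(N : ℝ) / 2) j * poch ((1 - (N : ℝ)) / 2) j
      = poch (-(N : ℝ)) (2 * j) * (1 / 4) ^ j := by
    induction j with
    | zero => simp [poch_zero]
    | succ j ih =>
      rw [poch_succ, poch_succ, show 2 * (j + 1) = 2 * j + 1 + 1 by ring, poch_succ, poch_succ,
        mul_mul_mul_comm, ih]
      push_cast; ring
  rw [h, poch_neg_natCast]; simp

theorem cast_descFactorial_eq_div {a j : ℕ} (h : j ≤ a) :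
    (a.descFactorial j : ℝ) = (a.factorial : ℝ) / (a - j).factorial := by
  have h1 : ((a - j).factorial : ℝ) ≠ 0 := by positivity
  rw [eq_div_iff h1, mul_comm]
  exact_mod_cast Nat.factorial_mul_descFactorial h

theorem ifact_natCast (a : ℕ) : ifact (a : ℤ) = a.factorial := by simp [ifact]

/-- The `k`-th monomial of `H_n(x) / n!`, set to zero beyond the range of the defining sum. -/
noncomputable def hermiteTerm (x : ℝ) (n k : ℕ) : ℝ :=
  if 2 * k ≤ n then (-1) ^ k * (2 * x) ^ (n - 2 * k) / ((k.factorial : ℝ) * (n - 2 * k).factorial)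
  else 0

theorem hermiteH_eq_sum_hermiteTerm {n N : ℕ} (h : n / 2 + 1 ≤ N) (x : ℝ) :
    hermiteH n x = n.factorial * ∑ k ∈ Finset.range N, hermiteTerm x n k := by
  rw [hermiteH, ← sum_range_eq_sum_range_of_vanish (f := hermiteTerm x n) (a := n / 2 + 1)
    (fun i hi => if_neg (by omega)) (fun i hi => if_neg (by omega))]
  congr 1
  refine Finset.sum_congr rfl fun k hk => ?_
  rw [Finset.mem_range] at hk
  rw [hermiteTerm, if_pos (by omega)]

theorem hermiteTerm_mul_sub (x : ℝ) (n k : ℕ) :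
    ((n : ℝ) + 1 - 2 * k) * hermiteTerm x (n + 1) k = 2 * x * hermiteTerm x n k := by
  unfold hermiteTerm
  by_cases h : 2 * k ≤ n
  · obtain ⟨r, rfl⟩ := Nat.exists_eq_add_of_le h
    rw [if_pos (by omega), if_pos h, show 2 * k + r + 1 - 2 * k = r + 1 by omega,
      show 2 * k + r - 2 * k = r by omega, Nat.factorial_succ]
    push_cast
    have : (r : ℝ) + 1 ≠ 0 := by positivity
    field_simp
    ring
  · rw [if_neg h]
    by_cases h' : 2 * k ≤ n + 1
    · have : (n : ℝ) + 1 = 2 * k := by exact_mod_cast (show n + 1 = 2 * k by omega)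
      rw [this]; ring
    · rw [if_neg h']; ring

theorem succ_mul_hermiteTerm (x : ℝ) (n k : ℕ) :
    ((k : ℝ) + 1) * hermiteTerm x (n + 2) (k + 1) = -hermiteTerm x n k := by
  unfold hermiteTerm
  by_cases h : 2 * k ≤ n
  · rw [if_pos (by omega), if_pos h, show n + 2 - 2 * (k + 1) = n - 2 * k by omega,
      Nat.factorial_succ]
    push_cast
    have : (k : ℝ) + 1 ≠ 0 := by positivity
    field_simp
    ring
  · rw [if_neg h, if_neg (by omega)]; ring

theorem hermiteH_add_two (n : ℕ) (x : ℝ) :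
    hermiteH (n + 2) x = 2 * x * hermiteH (n + 1) x - 2 * (n + 1) * hermiteH n x := by
  have key : ((n : ℝ) + 2) * ∑ k ∈ Finset.range (n + 4), hermiteTerm x (n + 2) k
      = 2 * x * ∑ k ∈ Finset.range (n + 4), hermiteTerm x (n + 1) k
        - 2 * ∑ k ∈ Finset.range (n + 3), hermiteTerm x n k := by
    have h1 : 2 * x * ∑ k ∈ Finset.range (n + 4), hermiteTerm x (n + 1) k
        = ∑ k ∈ Finset.range (n + 4), ((n : ℝ) + 2 - 2 * k) * hermiteTerm x (n + 2) k := by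
      rw [Finset.mul_sum]
      refine Finset.sum_congr rfl fun k _ => ?_
      rw [← hermiteTerm_mul_sub]; push_cast; ring
    have h2 : 2 * ∑ k ∈ Finset.range (n + 3), hermiteTerm x n k
        = -∑ k ∈ Finset.range (n + 4), 2 * (k : ℝ) * hermiteTerm x (n + 2) k := by
      rw [Finset.sum_range_succ' _ (n + 3), Finset.mul_sum]
      simp only [Nat.cast_zero, mul_zero, zero_mul, add_zero, ← Finset.sum_neg_distrib]
      refine Finset.sum_congr rfl fun k _ => ?_
      push_cast
      linear_combination 2 * succ_mul_hermiteTerm x n k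
    rw [h1, h2, sub_neg_eq_add, ← Finset.sum_add_distrib, Finset.mul_sum]
    exact Finset.sum_congr rfl fun k _ => by ring
  rw [hermiteH_eq_sum_hermiteTerm (n := n + 2) (N := n + 4) (by omega),
    hermiteH_eq_sum_hermiteTerm (n := n + 1) (N := n + 4) (by omega),
    hermiteH_eq_sum_hermiteTerm (n := n) (N := n + 3) (by omega),
    Nat.factorial_succ (n + 1), Nat.factorial_succ n]
  push_cast
  linear_combination ((n : ℝ) + 1) * n.factorial * key

theorem hermiteH_zero (x : ℝ) : hermiteH 0 x = 1 := by simp [hermiteH]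

theorem hermiteH_one (x : ℝ) : hermiteH 1 x = 2 * x := by simp [hermiteH]

theorem two_mul_mul_hermiteH (n : ℕ) (x : ℝ) :
    2 * x * hermiteH n x = hermiteH (n + 1) x + 2 * n * hermiteH (n - 1) x := by
  cases n with
  | zero => simp [hermiteH_zero, hermiteH_one]
  | succ n => rw [hermiteH_add_two]; push_cast; simp

theorem hermiteLin_zero_right (m n : ℕ) : hermiteLin m n 0 = 1 := by simp [hermiteLin]

theorem hermiteLin_of_lt_left {m j : ℕ} (n : ℕ) (h : m < j) : hermiteLin m n j = 0 := by
  simp [hermiteLin, Nat.choose_eq_zero_of_lt h]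

theorem hermiteLin_of_lt_right (m : ℕ) {n j : ℕ} (h : n < j) : hermiteLin m n j = 0 := by
  simp [hermiteLin, Nat.descFactorial_of_lt h]

theorem hermiteLin_succ_succ (m n j : ℕ) :
    hermiteLin (m + 1) n (j + 1)
      = hermiteLin m n (j + 1) + 2 * ((n : ℝ) - j) * hermiteLin m n j := by
  rcases le_or_gt j n with h | h
  · rw [hermiteLin, hermiteLin, hermiteLin, Nat.choose_succ_succ, Nat.descFactorial_succ]
    push_cast [Nat.cast_sub h]; ring
  · rw [hermiteLin_of_lt_right _ h, hermiteLin_of_lt_right _ (by omega : n < j + 1),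
      hermiteLin_of_lt_right _ (by omega : n < j + 1)]
    ring

theorem sub_mul_hermiteLin_succ (m n j : ℕ) :
    ((m : ℝ) + 1 - j) * hermiteLin (m + 1) n j = (m + 1) * hermiteLin m n j := by
  rcases le_or_gt j (m + 1) with h | h
  · have hc : (m.choose j : ℝ) * (m + 1) = ((m + 1).choose j : ℝ) * (m + 1 - j) := by
      have := congrArg (Nat.cast : ℕ → ℝ) (Nat.choose_mul_succ_eq m j)
      push_cast [Nat.cast_sub h] at this
      exact this
    rw [hermiteLin, hermiteLin]
    linear_combination -2 ^ j * (n.descFactorial j : ℝ) * hc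
  · rw [hermiteLin_of_lt_left _ h, hermiteLin_of_lt_left _ (by omega : m < j)]; ring

/-- Linearization of the product of two Hermite polynomials. -/
theorem hermiteH_mul_hermiteH (m n : ℕ) (x : ℝ) :
    hermiteH m x * hermiteH n x
      = ∑ j ∈ Finset.range (m + 1), hermiteLin m n j * hermiteH (m + n - 2 * j) x := by
  induction m using Nat.twoStepInduction with
  | zero => simp [hermiteH_zero, hermiteLin_zero_right]
  | one =>
    rw [hermiteH_one, two_mul_mul_hermiteH]
    simp [Finset.sum_range_succ, hermiteLin, add_comm 1 n]
  | more m ih0 ih1 =>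
    have hext : ∑ j ∈ Finset.range (m + 1), hermiteLin m n j * hermiteH (m + n - 2 * j) x
        = ∑ j ∈ Finset.range (m + 2), hermiteLin m n j * hermiteH (m + n - 2 * j) x := by
      rw [Finset.sum_range_succ _ (m + 1), hermiteLin_of_lt_left n (Nat.lt_succ_self m)]; ring
    have hL : hermiteH (m + 2) x * hermiteH n x
        = 2 * x * (hermiteH (m + 1) x * hermiteH n x)
          - 2 * (m + 1) * (hermiteH m x * hermiteH n x) := by
      rw [hermiteH_add_two]; ring
    have hR : ∑ j ∈ Finset.range (m + 3), hermiteLin (m + 2) n j * hermiteH (m + 2 + n - 2 * j) x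
        = ∑ j ∈ Finset.range (m + 2), hermiteLin (m + 1) n j * hermiteH (m + 2 + n - 2 * j) x
          + ∑ j ∈ Finset.range (m + 2),
            2 * ((n : ℝ) - j) * hermiteLin (m + 1) n j * hermiteH (m + n - 2 * j) x := by
      have h0 : ∑ j ∈ Finset.range (m + 2),
            hermiteLin (m + 1) n j * hermiteH (m + 2 + n - 2 * j) x
          = ∑ j ∈ Finset.range (m + 3),
            hermiteLin (m + 1) n j * hermiteH (m + 2 + n - 2 * j) x := by
        rw [Finset.sum_range_succ _ (m + 2), hermiteLin_of_lt_left n (Nat.lt_succ_self (m + 1))]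
        ring
      rw [h0, Finset.sum_range_succ', Finset.sum_range_succ' _ (m + 2), hermiteLin_zero_right,
        hermiteLin_zero_right, add_right_comm (Finset.sum _ _ : ℝ), ← Finset.sum_add_distrib]
      congr 1
      refine Finset.sum_congr rfl fun j _ => ?_
      rw [hermiteLin_succ_succ, show m + 2 + n - 2 * (j + 1) = m + n - 2 * j by omega]
      ring
    rw [hL, ih0, ih1, hext, hR, Finset.mul_sum, Finset.mul_sum, ← Finset.sum_sub_distrib,
      ← Finset.sum_add_distrib]
    refine Finset.sum_congr rfl fun j hj => ?_
    rw [Finset.mem_range] at hj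
    rcases le_or_gt j n with h | h
    · have hrec := two_mul_mul_hermiteH (m + 1 + n - 2 * j) x
      rw [Nat.cast_sub (by omega)] at hrec
      rw [show m + 2 + n - 2 * j = m + 1 + n - 2 * j + 1 by omega]
      rw [show m + 1 + n - 2 * j - 1 = m + n - 2 * j by omega] at hrec
      push_cast at hrec
      linear_combination hermiteLin (m + 1) n j * hrec
        + 2 * hermiteH (m + n - 2 * j) x * sub_mul_hermiteLin_succ m n j
    · simp [hermiteLin_of_lt_right _ h]

theorem hermiteLin_eq_div {m n j : ℕ} (hm : j ≤ m) (hn : j ≤ n) :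
    hermiteLin m n j = 2 ^ j * m.factorial * n.factorial
      / ((j.factorial : ℝ) * (m - j).factorial * (n - j).factorial) := by
  rw [hermiteLin, Nat.cast_choose ℝ hm, cast_descFactorial_eq_div hn]
  field_simp

theorem hermd_eq_sum {k p m n : ℕ} (hk : k < p) (hpm : p ≤ m) (hmn : m ≤ n) :
    hermd k p m n = ∑ j ∈ Finset.range (m + 1),
      if j ≤ k then hermiteLin m n j * hermiteLin p (m + n - 2 * j) (k - j) else 0 := by
  rw [hermd, hypSum, tsum_eq_sum (s := Finset.range (m + 1)), Finset.mul_sum]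
  · refine Finset.sum_congr rfl fun j hj => ?_
    have hjm : j ≤ m := by simpa [Nat.lt_succ_iff] using hj
    have e1 : (p : ℤ) - k = ((p - k : ℕ) : ℤ) := by omega
    have e2 : (m : ℤ) + n - k = ((m + n - k : ℕ) : ℤ) := by omega
    have e3 : -(m : ℝ) - n + k = -((m + n - k : ℕ) : ℝ) := by
      rw [Nat.cast_sub (by omega)]; push_cast; ring
    have e4 : 1 + (p : ℝ) - k = 1 + ((p - k : ℕ) : ℝ) := by
      rw [Nat.cast_sub (by omega)]; ring
    have e5 : (-(m : ℝ) - n) / 2 = -((m + n : ℕ) : ℝ) / 2 := by push_cast; ring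
    have e6 : (1 - (m : ℝ) - n) / 2 = (1 - ((m + n : ℕ) : ℝ)) / 2 := by push_cast; ring
    rw [e1, e2, e3, e4, e5, e6]
    simp only [List.map_cons, List.map_nil, List.prod_cons, List.prod_nil, mul_one,
      ifact_natCast, poch_neg_natCast, poch_one_add_natCast, poch_half_mul_poch_half]
    split_ifs with hjk
    · rw [hermiteLin_eq_div hjm (hjm.trans hmn), hermiteLin_eq_div (by omega) (by omega)]
      rw [cast_descFactorial_eq_div hjk, cast_descFactorial_eq_div hjm,
        cast_descFactorial_eq_div (hjm.trans hmn), cast_descFactorial_eq_div (by omega),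
        cast_descFactorial_eq_div (by omega : 2 * j ≤ m + n)]
      rw [show p - (k - j) = p - k + j by omega,
        show m + n - 2 * j - (k - j) = m + n - k - j by omega]
      have h2 : (2 : ℝ) ^ k = 2 ^ j * 2 ^ (k - j) := by rw [← pow_add]; congr 1; omega
      have h4 : ((-1 : ℝ) ^ j) ^ 4 = 1 := by rw [← pow_mul, mul_comm, pow_mul]; norm_num
      rw [h2]
      generalize (-1 : ℝ) ^ j = s at h4 ⊢
      generalize hq : ((1 : ℝ) / 4) ^ j = q
      have hq0 : q ≠ 0 := by rw [← hq]; positivity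
      field_simp
      rw [h4]
    · simp [Nat.descFactorial_of_lt (not_le.mp hjk)]
  · intro j hj
    have hjm : m < j := by simpa using hj
    simp [poch_neg_natCast, Nat.descFactorial_of_lt hjm]

theorem herme_eq_sum {k p m n : ℕ} (hk : p ≤ k) (hk2 : 2 * k ≤ p + m + n) (hmn : m ≤ n) :
    herme k p m n = ∑ j ∈ Finset.range (m + 1),
      if j ≤ k then hermiteLin m n j * hermiteLin p (m + n - 2 * j) (k - j) else 0 := by
  obtain ⟨s, rfl⟩ := Nat.exists_eq_add_of_le hk
  rcases lt_or_ge m s with hms | hms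
  · have h0 : ifact ((m : ℤ) + p - (p + s : ℕ)) = 0 := if_neg (by push_cast; omega)
    rw [herme, h0, Finset.sum_eq_zero]
    · simp
    · intro j hj
      rw [Finset.mem_range] at hj
      rw [hermiteLin_of_lt_left _ (by omega : p < p + s - j)]
      simp
  obtain ⟨u, rfl⟩ := Nat.exists_eq_add_of_le hms
  obtain ⟨v, rfl⟩ := Nat.exists_eq_add_of_le hmn
  obtain ⟨q, hq⟩ := Nat.exists_eq_add_of_le (show p ≤ 2 * u + v by omega)
  have hqR : (2 * u + v : ℝ) = p + q := by exact_mod_cast hq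
  have e1 : ((s + u : ℕ) : ℤ) + (s + u + v : ℕ) + 2 * p - 2 * (p + s : ℕ)
      = ((2 * u + v : ℕ) : ℤ) := by push_cast; ring
  have e2 : ((p + s : ℕ) : ℤ) - p = (s : ℕ) := by push_cast; ring
  have e3 : ((s + u : ℕ) : ℤ) + p - (p + s : ℕ) = (u : ℕ) := by push_cast; ring
  have e4 : ((s + u + v : ℕ) : ℤ) + p - (p + s : ℕ) = (u + v : ℕ) := by push_cast; ring
  have e5 : (p : ℤ) + (s + u : ℕ) + (s + u + v : ℕ) - 2 * (p + s : ℕ) = (q : ℕ) := by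
    push_cast; omega
  have e6 : -((s + u : ℕ) : ℝ) - p + (p + s : ℕ) = -(u : ℝ) := by push_cast; ring
  have e7 : -((s + u + v : ℕ) : ℝ) - p + (p + s : ℕ) = -((u + v : ℕ) : ℝ) := by push_cast; ring
  have e8 : -((s + u : ℕ) : ℝ) - (s + u + v : ℕ) - p + 2 * (p + s : ℕ) = -(q : ℝ) := by
    push_cast; linear_combination -hqR
  have e9 : 1 + ((p + s : ℕ) : ℝ) - p = 1 + (s : ℝ) := by push_cast; ring
  have e10 : (2 * ((p + s : ℕ) : ℝ) - 2 * p - (s + u : ℕ) - (s + u + v : ℕ)) / 2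
      = -((2 * u + v : ℕ) : ℝ) / 2 := by push_cast; ring
  have e11 : (1 + 2 * ((p + s : ℕ) : ℝ) - 2 * p - (s + u : ℕ) - (s + u + v : ℕ)) / 2
      = (1 - ((2 * u + v : ℕ) : ℝ)) / 2 := by push_cast; ring
  rw [herme, e1, e2, e3, e4, e5, e6, e7, e8, e9, e10, e11, add_assoc s u 1, Finset.sum_range_add,
    Finset.sum_eq_zero (s := Finset.range s), zero_add, hypSum,
    tsum_eq_sum (s := Finset.range (u + 1)), Finset.mul_sum]
  · refine Finset.sum_congr rfl fun l hl => ?_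
    have hlu : l ≤ u := by simpa [Nat.lt_succ_iff] using hl
    simp only [List.map_cons, List.map_nil, List.prod_cons, List.prod_nil, mul_one,
      ifact_natCast, poch_neg_natCast, poch_one_add_natCast, poch_half_mul_poch_half]
    rcases lt_or_ge p l with hpl | hpl
    · rw [if_neg (by omega)]
      simp [Nat.descFactorial_of_lt hpl]
    rw [if_pos (by omega)]
    rcases lt_or_ge q l with hql | hql
    · rw [hermiteLin_of_lt_right p (by omega)]
      simp [Nat.descFactorial_of_lt hql]
    rw [hermiteLin_eq_div (by omega) (by omega), hermiteLin_eq_div (by omega) (by omega),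
      cast_descFactorial_eq_div hpl, cast_descFactorial_eq_div hlu,
      cast_descFactorial_eq_div (by omega : l ≤ u + v), cast_descFactorial_eq_div hql,
      cast_descFactorial_eq_div (by omega : 2 * l ≤ 2 * u + v),
      show s + u - (s + l) = u - l by omega, show s + u + v - (s + l) = u + v - l by omega,
      show p + s - (s + l) = p - l by omega, show p - (p - l) = l by omega,
      show s + u + (s + u + v) - 2 * (s + l) = 2 * u + v - 2 * l by omega,
      show 2 * u + v - 2 * l - (p - l) = q - l by omega]
    have h2 : (2 : ℝ) ^ (p + s) = 2 ^ (s + l) * 2 ^ (p - l) := by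
      rw [← pow_add]; congr 1; omega
    have h4 : ((-1 : ℝ) ^ l) ^ 4 = 1 := by rw [← pow_mul, mul_comm, pow_mul]; norm_num
    rw [h2]
    generalize (-1 : ℝ) ^ l = t at h4 ⊢
    generalize hw : ((1 : ℝ) / 4) ^ l = w
    have hw0 : w ≠ 0 := by rw [← hw]; positivity
    field_simp
    rw [h4]
  · intro l hl
    have hul : u < l := by simpa using hl
    simp [poch_neg_natCast, Nat.descFactorial_of_lt hul]
  · intro j hj
    rw [Finset.mem_range] at hj
    rw [hermiteLin_of_lt_left _ (by omega : p < p + s - j)]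
    simp

theorem hermf_eq_sum {k p m n : ℕ} (hk : 2 * k ≤ p + m + n) (hpm : p ≤ m) (hmn : m ≤ n) :
    hermf k p m n = ∑ j ∈ Finset.range (m + 1),
      if j ≤ k then hermiteLin m n j * hermiteLin p (m + n - 2 * j) (k - j) else 0 := by
  unfold hermf
  split_ifs with h
  · exact hermd_eq_sum h hpm hmn
  · exact herme_eq_sum (not_lt.mp h) hk hmn

theorem sum_range_ite_sub (G : ℕ → ℝ) (j N : ℕ) :
    ∑ k ∈ Finset.range N, (if j ≤ k then G (k - j) else 0) = ∑ i ∈ Finset.range (N - j), G i := by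
  rw [← Finset.sum_filter]
  have : (Finset.range N).filter (fun k => j ≤ k) = Finset.Ico j N := by
    ext k; simp [and_comm]
  rw [this, Finset.sum_Ico_eq_sum_range]
  simp

theorem stmt8 (p m n : ℕ) (hpm : p ≤ m) (hmn : m ≤ n) (x : ℝ) :
    hermiteH p x * hermiteH m x * hermiteH n x =
      ∑ k ∈ Finset.range ((p + m + n) / 2 + 1),
        hermf k p m n * hermiteH (p + m + n - 2 * k) x := by
  have hR : ∑ k ∈ Finset.range ((p + m + n) / 2 + 1),
        hermf k p m n * hermiteH (p + m + n - 2 * k) x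
      = ∑ k ∈ Finset.range ((p + m + n) / 2 + 1), ∑ j ∈ Finset.range (m + 1),
        if j ≤ k then hermiteLin m n j * (hermiteLin p (m + n - 2 * j) (k - j)
          * hermiteH (p + (m + n - 2 * j) - 2 * (k - j)) x) else 0 := by
    refine Finset.sum_congr rfl fun k hk => ?_
    rw [Finset.mem_range] at hk
    rw [hermf_eq_sum (by omega) hpm hmn, Finset.sum_mul]
    refine Finset.sum_congr rfl fun j hj => ?_
    rw [Finset.mem_range] at hj
    split_ifs with hjk
    · rw [show p + (m + n - 2 * j) - 2 * (k - j) = p + m + n - 2 * k by omega]; ring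
    · ring
  rw [hR, Finset.sum_comm, mul_assoc, hermiteH_mul_hermiteH m n, Finset.mul_sum]
  refine Finset.sum_congr rfl fun j hj => ?_
  rw [Finset.mem_range] at hj
  rw [sum_range_ite_sub (fun i => hermiteLin m n j * (hermiteLin p (m + n - 2 * j) i
    * hermiteH (p + (m + n - 2 * j) - 2 * i) x)), ← Finset.mul_sum, mul_left_comm,
    hermiteH_mul_hermiteH]
  congr 1
  refine sum_range_eq_sum_range_of_vanish (fun i hi => ?_) (fun i hi => ?_)
  · rw [hermiteLin_of_lt_left _ (by omega)]; ring
  · rcases lt_or_ge p i with h | h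
    · rw [hermiteLin_of_lt_left _ h]; ring
    · rw [hermiteLin_of_lt_right _ (by omega)]; ring
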